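/- Let F be a field and let B be a 4-dimensional associative unital F-algebra equipped with a standard involution σ. Then B is a quaternion algebra over F (i.e., a central simple F-algebra of dimension 4) if and only if the reduced norm nrd is nonsingular, i.e., rad(nrd) = {0}. -/

import Mathlib

/-- A standard involution on an associative unital `F`-algebra `B` is an `F`-linear map
`σ : B → B` with `σ 1 = 1`, `σ (x * y) = σ y * σ x`, `σ (σ x) = x`, and such that
`x * σ x` lies in the image of `F` in `B` for every `x`. -/
def IsStandardInvolution (F B : Type*) [Field F] [Ring B] [Algebra F B]
    (σ : B →ₗ[F] B) : Prop :=
  σ 1 = 1 ∧ (∀ x y : B, σ (x * y) = σ y * σ x) ∧ (∀ x : B, σ (σ x) = x) ∧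
    ∀ x : B, x * σ x ∈ (algebraMap F B).range

namespace IsStandardInvolution

variable {F B : Type*} [Field F] [Ring B] [Algebra F B] {σ : B →ₗ[F] B}

theorem polar_eq (x y : B) :
    (x + y) * σ (x + y) - x * σ x - y * σ y = x * σ y + y * σ x := by
  rw [map_add]
  noncomm_ring

theorem map_algebraMap (hσ : IsStandardInvolution F B σ) (c : F) :
    σ (algebraMap F B c) = algebraMap F B c := by
  rw [Algebra.algebraMap_eq_smul_one, map_smul, hσ.1]

theorem exists_trace (hσ : IsStandardInvolution F B σ) (x : B) :
    ∃ t : F, σ x = algebraMap F B t - x := by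
  obtain ⟨a, ha⟩ := hσ.2.2.2 (x + 1)
  obtain ⟨b, hb⟩ := hσ.2.2.2 x
  refine ⟨a - b - 1, ?_⟩
  rw [map_sub, map_sub, ha, hb, map_add, hσ.1, map_one]
  noncomm_ring

/-- `x` and `σ x` commute. -/
theorem mul_map_self (hσ : IsStandardInvolution F B σ) (x : B) : x * σ x = σ x * x := by
  obtain ⟨t, ht⟩ := hσ.exists_trace x
  rw [ht, mul_sub, sub_mul, Algebra.commutes]

theorem polar_map (hσ : IsStandardInvolution F B σ) (x y : B) :
    x * σ y + y * σ x = σ x * y + σ y * x := by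
  have h := hσ.mul_map_self (x + y)
  rw [← sub_eq_zero] at h ⊢
  have hx := sub_eq_zero.2 (hσ.mul_map_self x)
  have hy := sub_eq_zero.2 (hσ.mul_map_self y)
  rw [map_add] at h
  have key : x * σ y + y * σ x - (σ x * y + σ y * x) =
      ((x + y) * (σ x + σ y) - (σ x + σ y) * (x + y)) - (x * σ x - σ x * x)
        - (y * σ y - σ y * y) := by
    noncomm_ring
  rw [key, h, hx, hy]
  simp

theorem polar_mul_right (hσ : IsStandardInvolution F B σ) (x z y : B) :
    x * z * σ y + y * σ (x * z) = x * σ (y * σ z) + y * σ z * σ x := by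
  rw [hσ.2.1, hσ.2.1, hσ.2.2.1]
  simp only [mul_assoc]

theorem polar_mul_left (hσ : IsStandardInvolution F B σ) (z x y : B) :
    z * x * σ y + y * σ (z * x) = x * σ (σ z * y) + σ z * y * σ x := by
  rw [hσ.polar_map, hσ.polar_map x, hσ.2.1, hσ.2.1, hσ.2.2.1]
  simp only [mul_assoc]

/-- The radical of the reduced norm, as a two-sided ideal. -/
def radical (hσ : IsStandardInvolution F B σ) : TwoSidedIdeal B :=
  TwoSidedIdeal.mk' {x | ∀ y, x * σ y + y * σ x = 0}
    (by simp)
    (fun {a b} ha hb y => by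
      have h : (a + b) * σ y + y * σ (a + b) =
          (a * σ y + y * σ a) + (b * σ y + y * σ b) := by
        rw [map_add]; noncomm_ring
      rw [h, ha y, hb y, add_zero])
    (fun {a} ha y => by
      have h : -a * σ y + y * σ (-a) = -(a * σ y + y * σ a) := by
        rw [map_neg]; noncomm_ring
      rw [h, ha y, neg_zero])
    (fun {a b} hb y => by rw [hσ.polar_mul_left]; exact hb _)
    (fun {a b} ha y => by rw [hσ.polar_mul_right]; exact ha _)

theorem mem_radical (hσ : IsStandardInvolution F B σ) {x : B} :
    x ∈ hσ.radical ↔ ∀ y, x * σ y + y * σ x = 0 := by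
  simp [radical, TwoSidedIdeal.mem_mk']

theorem commute_of_one_mem_radical (hσ : IsStandardInvolution F B σ)
    (h : (1 : B) ∈ hσ.radical) (x y : B) : x * y = y * x := by
  have hneg (y : B) : σ y = -y := by
    have := hσ.mem_radical.1 h y
    rw [hσ.1, one_mul, mul_one] at this
    exact eq_neg_of_add_eq_zero_left this
  have htwo : (1 : B) = -1 := by rw [← hneg, hσ.1]
  have hxy := hσ.2.1 x y
  rw [hneg, hneg, hneg, neg_mul_neg] at hxy
  rw [← hxy, ← neg_one_mul (x * y), ← htwo, one_mul]

theorem radical_eq_bot (hσ : IsStandardInvolution F B σ) (hdim : Module.finrank F B ≠ 1)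
    [Algebra.IsCentral F B] [IsSimpleRing B] : hσ.radical = ⊥ := by
  refine (eq_bot_or_eq_top hσ.radical).resolve_right fun htop => hdim ?_
  have hcomm := hσ.commute_of_one_mem_radical (htop ▸ trivial)
  have hbot : (⊥ : Subalgebra F B) = ⊤ := by
    rw [← Algebra.IsCentral.center_eq_bot F B, eq_top_iff]
    exact fun x _ => Subalgebra.mem_center_iff.2 fun y => hcomm y x
  exact Subalgebra.bot_eq_top_iff_finrank_eq_one.1 hbot

/-- A central element of trace zero whose square is zero lies in the radical. -/
theorem mem_radical_of_central (hσ : IsStandardInvolution F B σ) [Nontrivial B] {w : B}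
    (hcomm : ∀ y, y * w = w * y) (hw : σ w = -w) (hsq : w * w = 0) : w ∈ hσ.radical := by
  refine hσ.mem_radical.2 fun y => ?_
  obtain ⟨t, ht⟩ := hσ.exists_trace (w * σ y)
  rw [hσ.2.1, hσ.2.2.1] at ht
  have hsum : w * σ y + y * σ w = algebraMap F B t := by rw [ht]; abel
  have hfactor : w * σ y + y * σ w = w * (σ y - y) := by
    rw [hw, mul_neg, hcomm, mul_sub, sub_eq_add_neg]
  have h0 : algebraMap F B (t * t) = 0 := by
    rw [map_mul, ← hsum, hfactor, mul_assoc, ← mul_assoc _ w, hcomm, mul_assoc, ← mul_assoc,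
      hsq, zero_mul]
  rw [map_eq_zero, mul_self_eq_zero] at h0
  rw [hsum, h0, map_zero]

theorem isCentral_of_radical_eq_bot (hσ : IsStandardInvolution F B σ)
    (hdim : 2 < Module.finrank F B) (hR : hσ.radical = ⊥) : Algebra.IsCentral F B := by
  have : Module.Finite F B := Module.finite_of_finrank_pos (by lia)
  have : Nontrivial B := Module.nontrivial_of_finrank_pos (R := F) (by lia)
  refine ⟨fun z hz => ?_⟩
  have hcomm (y : B) : y * z = z * y := Subalgebra.mem_center_iff.1 hz y
  obtain ⟨t, ht⟩ := hσ.exists_trace z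
  have hw_comm (y : B) : y * (z - σ z) = (z - σ z) * y := by
    rw [ht, mul_sub, sub_mul, mul_sub, sub_mul, hcomm, Algebra.commutes]
  have hw_map : σ (z - σ z) = -(z - σ z) := by
    rw [map_sub, hσ.2.2.1, neg_sub]
  have hrel (x : B) : ∃ s u : F, σ x = algebraMap F B s - x ∧
      (z - σ z) * x = algebraMap F B u + algebraMap F B s * z := by
    obtain ⟨s, hs⟩ := hσ.exists_trace x
    obtain ⟨r, hr⟩ := hσ.exists_trace (z * x)
    refine ⟨s, r - s * t, hs, ?_⟩
    rw [hσ.2.1, hs, ht] at hr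
    rw [ht, map_sub, map_mul, eq_add_of_sub_eq' hr.symm]
    simp only [sub_mul, mul_sub, hcomm x, Algebra.commutes t x]
    abel
  have hw_sq : ∃ c : F, (z - σ z) * (z - σ z) = algebraMap F B c := by
    obtain ⟨c, hc⟩ := hσ.2.2.2 (z - σ z)
    exact ⟨-c, by rw [map_neg, hc, hw_map, mul_neg, neg_neg]⟩
  obtain ⟨c, hc⟩ := hw_sq
  have hc0 : c = 0 := by
    classical
    by_contra hc0
    have hinj : Function.Injective (LinearMap.mulLeft F (z - σ z)) := by
      refine (injective_iff_map_eq_zero _).2 fun x hx => ?_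
      rw [LinearMap.mulLeft_apply] at hx
      have h : c • x = 0 := by
        rw [Algebra.smul_def, ← hc, mul_assoc, hx, mul_zero]
      exact (smul_eq_zero.1 h).resolve_left hc0
    have hle : LinearMap.range (LinearMap.mulLeft F (z - σ z)) ≤
        Submodule.span F (({1, z} : Finset B) : Set B) := by
      rintro _ ⟨x, rfl⟩
      obtain ⟨s, u, -, h⟩ := hrel x
      rw [LinearMap.mulLeft_apply, h, ← Algebra.smul_def, Algebra.algebraMap_eq_smul_one,
        Finset.coe_pair]
      exact Submodule.mem_span_pair.2 ⟨u, s, rfl⟩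
    have h1 := Submodule.finrank_mono hle
    rw [LinearMap.finrank_range_of_inj hinj] at h1
    have h2 := finrank_span_finset_le_card (R := F) ({1, z} : Finset B)
    have h3 := Finset.card_le_two (a := (1 : B)) (b := z)
    rw [Set.finrank] at h2
    lia
  have hw : z - σ z = 0 := by
    have := hσ.mem_radical_of_central hw_comm hw_map (by rw [hc, hc0, map_zero])
    rwa [hR, TwoSidedIdeal.mem_bot] at this
  have hone : (1 : B) ∉ hσ.radical := by
    rw [hR, TwoSidedIdeal.mem_bot]
    exact one_ne_zero
  rw [hσ.mem_radical] at hone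
  push Not at hone
  obtain ⟨x, hx⟩ := hone
  obtain ⟨s, u, hs, h⟩ := hrel x
  rw [hσ.1, one_mul, mul_one, hs, sub_add_cancel] at hx
  have hs0 : s ≠ 0 := fun h0 => hx (by rw [h0, map_zero])
  rw [hw, zero_mul, ← Algebra.smul_def] at h
  refine Algebra.mem_bot.2 ⟨s⁻¹ * -u, ?_⟩
  rw [map_mul, map_neg, neg_eq_of_add_eq_zero_right h.symm, ← Algebra.smul_def,
    inv_smul_smul₀ hs0]

theorem eq_zero_of_algebraMap_mem {I : TwoSidedIdeal B} (hI : I ≠ ⊤) {c : F}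
    (hc : algebraMap F B c ∈ I) : c = 0 := by
  by_contra h0
  refine hI (TwoSidedIdeal.one_mem_iff I |>.1 ?_)
  have := I.mul_mem_left (algebraMap F B c⁻¹) _ hc
  rwa [← map_mul, inv_mul_cancel₀ h0, map_one] at this

/-- A proper ideal meets its conjugate only inside the radical. -/
theorem mem_radical_of_mem_of_map_mem (hσ : IsStandardInvolution F B σ)
    {I : TwoSidedIdeal B} (hI : I ≠ ⊤) {x : B} (hx : x ∈ I) (hx' : σ x ∈ I) :
    x ∈ hσ.radical := by
  refine hσ.mem_radical.2 fun y => ?_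
  obtain ⟨t, ht⟩ := hσ.exists_trace (x * σ y)
  rw [hσ.2.1, hσ.2.2.1] at ht
  have hsum : x * σ y + y * σ x = algebraMap F B t := by rw [ht]; abel
  have hmem := I.add_mem (I.mul_mem_right _ (σ y) hx) (I.mul_mem_left y _ hx')
  rw [hsum] at hmem ⊢
  rw [eq_zero_of_algebraMap_mem hI hmem, map_zero]

theorem isSimpleRing_of_radical_eq_bot (hσ : IsStandardInvolution F B σ) [Nontrivial B]
    [Algebra.IsCentral F B] (hR : hσ.radical = ⊥) : IsSimpleRing B := by
  refine ⟨⟨fun I => or_iff_not_imp_right.2 fun hI => ?_⟩⟩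
  rw [eq_bot_iff, ← hR]
  refine fun x hx => hσ.mem_radical.2 fun y => ?_
  obtain ⟨t, ht⟩ := hσ.exists_trace (x * σ y)
  have hsum : x * σ y + y * σ x = algebraMap F B t := by
    rw [hσ.2.1, hσ.2.2.1] at ht
    rw [ht]; abel
  rw [hsum]
  have he : x * σ y ∈ I := I.mul_mem_right _ _ hx
  generalize x * σ y = e at he ht
  by_contra ht0
  replace ht0 : t ≠ 0 := fun h => ht0 (by rw [h, map_zero])
  have hzero {a : B} (ha : a ∈ I) (ha' : σ a ∈ I) : a = 0 := by
    have := hσ.mem_radical_of_mem_of_map_mem hI ha ha'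
    rwa [hR, TwoSidedIdeal.mem_bot] at this
  have h1 (b : B) : e * b * σ e = 0 := by
    refine hzero (I.mul_mem_right _ _ (I.mul_mem_right _ _ he)) ?_
    rw [hσ.2.1, hσ.2.1, hσ.2.2.1]
    exact I.mul_mem_right _ _ he
  have h2 (b : B) : σ e * b * e = 0 := by
    refine hzero (I.mul_mem_left _ _ he) ?_
    rw [hσ.2.1, hσ.2.1, hσ.2.2.1]
    exact I.mul_mem_left _ _ (I.mul_mem_left _ _ he)
  have hcenter : e ∈ Subalgebra.center F B := by
    refine Subalgebra.mem_center_iff.2 fun b => ?_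
    have h1 := h1 b
    have h2 := h2 b
    rw [ht, mul_sub, ← Algebra.commutes, ← Algebra.smul_def, sub_eq_zero] at h1
    rw [ht, sub_mul, sub_mul, mul_assoc, ← Algebra.smul_def, sub_eq_zero] at h2
    exact smul_right_injective B ht0 (h2.trans h1.symm)
  rw [Algebra.IsCentral.center_eq_bot, Algebra.mem_bot] at hcenter
  obtain ⟨c, rfl⟩ := hcenter
  have hc := eq_zero_of_algebraMap_mem hI he
  rw [hc, map_zero, map_zero, sub_zero, eq_comm, map_eq_zero] at ht
  exact ht0 ht

end IsStandardInvolution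

/-- Let `F` be a field and let `B` be a `4`-dimensional associative
unital `F`-algebra with a standard involution `σ`.  Then `B` is a quaternion algebra
over `F` (a central simple `F`-algebra of dimension `4`) if and only if the reduced
norm `nrd x = x * σ x` is nonsingular, i.e. the radical of its polar bilinear form
`T(x, y) = nrd (x + y) - nrd x - nrd y` is trivial. -/
theorem isQuaternionAlgebra_iff_nrd_nonsingular
    (F B : Type*) [Field F] [Ring B] [Algebra F B]
    (hdim : Module.finrank F B = 4)
    (σ : B →ₗ[F] B) (hσ : IsStandardInvolution F B σ) :
    (Algebra.IsCentral F B ∧ IsSimpleRing B) ↔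
      ∀ x : B, (∀ y : B, (x + y) * σ (x + y) - x * σ x - y * σ y = 0) → x = 0 := by
  have hrad : (∀ x : B, (∀ y : B, (x + y) * σ (x + y) - x * σ x - y * σ y = 0) → x = 0) ↔
      hσ.radical = ⊥ := by
    simp only [IsStandardInvolution.polar_eq, ← hσ.mem_radical]
    rw [eq_bot_iff]
    rfl
  rw [hrad]
  constructor
  · rintro ⟨_, _⟩
    exact hσ.radical_eq_bot (by lia)
  · intro hR
    have : Nontrivial B := Module.nontrivial_of_finrank_pos (R := F) (by lia)
    have := hσ.isCentral_of_radical_eq_bot (by lia) hR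
    exact ⟨this, hσ.isSimpleRing_of_radical_eq_bot hR⟩
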